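/- Fix a squarefree integer D > 1 and a real number ε > 0. There exists a constant C > 0, depending only on D and ε, such that for every totally real quartic number field K containing √D with discriminant Δ and every positive integer m with m ≤ C·Δ^{1/4−ε}, there exists an element of mO_K^+ that is not a sum of squares of elements of O_K. -/

import Mathlib

open NumberField

/-- An element `α` of the ring of integers of `K` is totally positive if `σ α > 0`
for every real embedding `σ : K →+* ℝ`. -/
def TotallyPositive (K : Type) [Field K] (α : 𝓞 K) : Prop :=
  ∀ σ : K →+* ℝ, 0 < σ (α : K)

/-- `α` is a sum of squares in a commutative ring. -/
def IsSumOfSquares {R : Type*} [CommRing R] (a : R) : Prop :=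
  ∃ (k : ℕ) (x : Fin k → R), a = ∑ i, (x i) ^ 2

theorem abs_discr_le_abs_discr_family {K : Type*} [Field K] [NumberField K] {ι : Type*} [Fintype ι]
    [DecidableEq ι] (v : ι → 𝓞 K) (hv : LinearIndependent ℚ (fun i ↦ (v i : K)))
    (hc : Fintype.card ι = Module.finrank ℚ K) :
    |(discr K : ℚ)| ≤ |Algebra.discr ℚ (fun i ↦ (v i : K))| := by
  have : Nonempty ι := Fintype.card_pos_iff.mp (hc ▸ Module.finrank_pos)
  let e : Module.Free.ChooseBasisIndex ℤ (𝓞 K) ≃ ι := Fintype.equivOfCardEq (by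
    rw [hc, ← RingOfIntegers.rank, Module.finrank_eq_card_chooseBasisIndex])
  let B := (integralBasis K).reindex e
  let P : Matrix ι ι ℤ := fun i j ↦ (RingOfIntegers.basis K).repr (v j) (e.symm i)
  have hP : B.toMatrix (fun i ↦ (v i : K)) = P.map (algebraMap ℤ ℚ) := by
    ext i j
    simp only [B, P, Module.Basis.toMatrix_apply, Module.Basis.repr_reindex_apply]
    exact integralBasis_repr_apply K (v j) (e.symm i)
  have hB : Algebra.discr ℚ B = discr K := by
    rw [coe_discr, Module.Basis.coe_reindex, Algebra.discr_reindex]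
  have hdisc := Algebra.discr_of_matrix_vecMul (A := ℚ) (B : ι → K)
    (B.toMatrix (fun i ↦ (v i : K)))
  rw [Module.Basis.toMatrix_map_vecMul, hP, hB, ← RingHom.mapMatrix_apply, ← RingHom.map_det] at hdisc
  have hne : Algebra.discr ℚ (fun i ↦ (v i : K)) ≠ 0 := by
    have := Algebra.discr_not_zero_of_basis ℚ (basisOfLinearIndependentOfCardEqFinrank hv hc)
    rwa [coe_basisOfLinearIndependentOfCardEqFinrank] at this
  have hdet : P.det ≠ 0 := by
    intro h
    simp [hdisc, h] at hne
  have h1 : (1 : ℚ) ≤ ((algebraMap ℤ ℚ) P.det) ^ 2 := by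
    have : (1 : ℤ) ≤ P.det ^ 2 := Int.add_one_le_iff.mpr (sq_pos_of_ne_zero hdet)
    simpa using (mod_cast this : (1 : ℚ) ≤ (P.det : ℚ) ^ 2)
  rw [hdisc, abs_mul, abs_of_nonneg (sq_nonneg ((algebraMap ℤ ℚ) P.det))]
  exact le_mul_of_one_le_left (abs_nonneg _) h1

theorem sqrt_abs_discr_le_sum_norm_sq {K : Type*} [Field K] [NumberField K]
    (hdeg : Module.finrank ℚ K = 4) {d : ℝ} (s x : 𝓞 K) (hs : ∀ φ : K →+* ℂ, ‖φ s‖ ^ 2 = d)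
    (hli : LinearIndependent ℚ ![(1 : K), s, x, s * x]) :
    √|(discr K : ℝ)| ≤ 24 * d * ∑ φ : K →+* ℂ, ‖φ x‖ ^ 2 := by
  let v : Fin 4 → 𝓞 K := ![1, s, x, s * x]
  have hv : (fun i ↦ (v i : K)) = ![(1 : K), s, x, s * x] := by
    ext i; fin_cases i <;> simp [v]
  let e : Fin 4 ≃ (K →ₐ[ℚ] ℂ) := Fintype.equivOfCardEq (by
    rw [AlgHom.card, hdeg, Fintype.card_fin])
  set T := ∑ φ : K →+* ℂ, ‖φ x‖ ^ 2 with hT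
  have hle (φ : K →ₐ[ℚ] ℂ) : ‖φ x‖ ≤ √T :=
    Real.le_sqrt_of_sq_le <| Finset.single_le_sum (f := fun φ : K →+* ℂ ↦ ‖φ x‖ ^ 2)
      (fun _ _ ↦ sq_nonneg _) (Finset.mem_univ (φ : K →+* ℂ))
  have hT0 : 0 ≤ T := Finset.sum_nonneg fun _ _ ↦ sq_nonneg _
  have hs' (φ : K →ₐ[ℚ] ℂ) : ‖φ s‖ = √d := by
    rw [← hs (φ : K →+* ℂ), Real.sqrt_sq (norm_nonneg _)]; rfl
  have hd : 0 ≤ d := by rw [← hs (e 0 : K →+* ℂ)]; positivity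
  have hmat := Algebra.discr_eq_det_embeddingsMatrixReindex_pow_two ℚ ℂ (fun i ↦ (v i : K)) e
  set A := Algebra.embeddingsMatrixReindex ℚ ℂ (fun i ↦ (v i : K)) e with hA
  have hAij (i j) : A i j = e j (v i) := by
    simp [hA, Algebra.embeddingsMatrixReindex, Algebra.embeddingsMatrix]
  have hdet : ‖A.det‖ ≤ 24 * d * T := by
    rw [← Matrix.det_transpose, Matrix.det_apply]
    calc _ ≤ ∑ π : Equiv.Perm (Fin 4), d * T := by
          refine norm_sum_le_of_le _ fun π _ ↦ ?_
          rw [Units.smul_def, zsmul_eq_mul, norm_mul, norm_prod, Fin.prod_univ_four]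
          have hsign : ‖(((Equiv.Perm.sign π : ℤˣ) : ℤ) : ℂ)‖ = 1 := by
            rcases Int.units_eq_one_or (Equiv.Perm.sign π) with h | h <;> simp [h]
          rw [hsign]
          simp only [Matrix.transpose_apply, hAij, v, Matrix.cons_val, map_mul, map_one, norm_mul, norm_one,
            one_mul, hs']
          calc √d * ‖e (π 2) x‖ * (√d * ‖e (π 3) x‖) ≤ √d * √T * (√d * √T) := by
                gcongr <;> exact hle _
            _ = (√d * √d) * (√T * √T) := by ring
            _ = d * T := by rw [Real.mul_self_sqrt hd, Real.mul_self_sqrt hT0]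
      _ = 24 * d * T := by
          simp [Fintype.card_perm, Nat.factorial, mul_assoc]
  refine Real.sqrt_le_iff.mpr ⟨by positivity, ?_⟩
  have h1 := abs_discr_le_abs_discr_family v (hv ▸ hli) (by simp [hdeg])
  calc |(discr K : ℝ)| ≤ |((Algebra.discr ℚ (fun i ↦ (v i : K)) : ℚ) : ℝ)| := by exact_mod_cast h1
    _ = ‖A.det‖ ^ 2 := by
        rw [← norm_pow, ← hmat, eq_ratCast, ← Complex.ofReal_ratCast, Complex.norm_real,
          Real.norm_eq_abs]
    _ ≤ _ := by gcongr

theorem sq_ne_of_squarefree {D : ℤ} (hD : Squarefree D) (hD1 : 1 < D) (q : ℚ) : q ^ 2 ≠ D := by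
  intro h
  have hq : IsIntegral ℤ q := IsIntegral.of_pow two_pos (by
    rw [h]; exact isIntegral_algebraMap (R := ℤ) (A := ℚ) (x := D))
  obtain ⟨n, rfl⟩ := IsIntegrallyClosed.isIntegral_iff.mp hq
  have hn : n * n = D := by
    rw [algebraMap_int_eq, eq_intCast] at h
    rw [← sq]
    exact_mod_cast h
  have := hD n (Dvd.intro 1 (by rw [mul_one, hn]))
  rw [← sq, Int.isUnit_sq this] at hn
  omega

/-- Membership in `ℚ + ℚ s`, for `s ^ 2 = D`. -/
def IsRatLinear {K : Type*} [Field K] [CharZero K] (s x : K) : Prop :=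
  ∃ a b : ℚ, x = a + b * s

section
variable {K : Type*} [Field K] [CharZero K] {D : ℤ} {s : K}

theorem IsRatLinear.sq {x : K} (hs : s ^ 2 = D) (hx : IsRatLinear s x) : IsRatLinear s (x ^ 2) := by
  obtain ⟨a, b, rfl⟩ := hx
  refine ⟨a ^ 2 + b ^ 2 * D, 2 * a * b, ?_⟩
  push_cast
  linear_combination (b : K) ^ 2 * hs

theorem IsRatLinear.sum {ι : Type*} (t : Finset ι) {f : ι → K} (h : ∀ i ∈ t, IsRatLinear s (f i)) :
    IsRatLinear s (∑ i ∈ t, f i) := by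
  refine Finset.sum_induction _ (IsRatLinear s) ?_ ⟨0, 0, by simp⟩ h
  rintro _ _ ⟨a, b, rfl⟩ ⟨c, e, rfl⟩
  exact ⟨a + c, b + e, by push_cast; ring⟩

theorem linearIndependent_of_not_isRatLinear (hD : Squarefree D) (hD1 : 1 < D) (hs : s ^ 2 = D)
    {x : K} (hx : ¬ IsRatLinear s x) : LinearIndependent ℚ ![(1 : K), s, x, s * x] := by
  have hirr (a b : ℚ) (h : (a : K) + b * s = 0) : a = 0 ∧ b = 0 := by
    have hab : a ^ 2 = b ^ 2 * D := by
      have : (a : K) ^ 2 = b ^ 2 * D := by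
        linear_combination (a - b * s : K) * h + (b : K) ^ 2 * hs
      exact_mod_cast this
    have hb : b = 0 := by
      by_contra hb
      refine sq_ne_of_squarefree hD hD1 (a / b) ?_
      field_simp
      exact hab
    subst hb
    exact ⟨by simpa using hab, rfl⟩
  rw [Fintype.linearIndependent_iff]
  intro g hg
  simp only [Fin.sum_univ_four, Matrix.cons_val, Rat.smul_def] at hg
  have h23 : g 2 = 0 ∧ g 3 = 0 := by
    by_contra hne
    have h0 : (g 2 : K) - g 3 * s ≠ 0 := fun h ↦ hne (by
      have := hirr (g 2) (-g 3) (by push_cast; linear_combination h)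
      simpa using this)
    have h1 : (g 2 : K) + g 3 * s ≠ 0 := fun h ↦ hne (hirr _ _ h)
    have hn : ((g 2 ^ 2 - g 3 ^ 2 * D : ℚ) : K) ≠ 0 := by
      have : ((g 2 ^ 2 - g 3 ^ 2 * D : ℚ) : K) = (g 2 - g 3 * s) * (g 2 + g 3 * s) := by
        push_cast
        linear_combination (g 3 : K) ^ 2 * hs
      rw [this]
      exact mul_ne_zero h0 h1
    refine hx ⟨-(g 0 * g 2 - g 1 * g 3 * D) / (g 2 ^ 2 - g 3 ^ 2 * D),
      -(g 1 * g 2 - g 0 * g 3) / (g 2 ^ 2 - g 3 ^ 2 * D), ?_⟩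
    push_cast at hn ⊢
    field_simp
    linear_combination (g 2 - g 3 * s : K) * hg + ((g 3 : K) ^ 2 * x + g 1 * g 3) * hs
  simp only [h23.1, h23.2, Rat.cast_zero, zero_mul, add_zero] at hg
  have h01 := hirr (g 0) (g 1) (by linear_combination hg)
  intro i
  fin_cases i
  exacts [h01.1, h01.2, h23.1, h23.2]
end

section
variable {K : Type*} [Field K] [NumberField K] {D : ℤ} {s : K}
open NumberField.InfinitePlace NumberField.mixedEmbedding

theorem exists_embedding_eq_neg (hD : Squarefree D) (hD1 : 1 < D) (hs : s ^ 2 = D) (φ : K →+* ℂ) :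
    ∃ ψ : K →+* ℂ, ψ s = - φ s := by
  by_contra! h
  have hsq (ψ : K →+* ℂ) : ψ s ^ 2 = D := by rw [← map_pow, hs, map_intCast]
  have heq (ψ : K →ₐ[ℚ] ℂ) : ψ s = φ s :=
    (sq_eq_sq_iff_eq_or_eq_neg.mp ((hsq ψ).trans (hsq φ).symm)).resolve_right (h ψ)
  have htr := trace_eq_sum_embeddings (K := ℚ) (L := K) ℂ (x := s)
  simp only [heq, Finset.sum_const, Finset.card_univ, AlgHom.card, nsmul_eq_mul, eq_ratCast] at htr
  have hn : (Module.finrank ℚ K : ℂ) ≠ 0 := by exact_mod_cast Module.finrank_pos.ne'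
  refine sq_ne_of_squarefree hD hD1 (Algebra.trace ℚ K s / Module.finrank ℚ K) ?_
  have : (((Algebra.trace ℚ K s / Module.finrank ℚ K : ℚ) ^ 2 : ℚ) : ℂ) = ((D : ℚ) : ℂ) := by
    push_cast
    rw [htr, mul_div_cancel_left₀ _ hn, hsq]
  exact_mod_cast this

theorem not_isRatLinear_of_norm_lt_one (hs : s ^ 2 = D) {φ ψ : K →+* ℂ} (h : ψ s = - φ s)
    {x : 𝓞 K} (hx : x ≠ 0) (hφ : ‖φ x‖ < 1) (hψ : ‖ψ x‖ < 1) : ¬ IsRatLinear s (x : K) := by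
  rintro ⟨a, b, hab⟩
  have hφs : φ s ^ 2 = D := by rw [← map_pow, hs, map_intCast]
  have hmul : φ x * ψ x = algebraMap ℚ ℂ (a ^ 2 - b ^ 2 * D) := by
    rw [hab]
    simp only [map_add, map_mul, map_ratCast, h, eq_ratCast]
    push_cast
    linear_combination - (b : ℂ) ^ 2 * hφs
  have hint : IsIntegral ℤ (φ x * ψ x) :=
    .mul (map_isIntegral_int φ x.isIntegral_coe) (map_isIntegral_int ψ x.isIntegral_coe)
  rw [hmul, isIntegral_algebraMap_iff (algebraMap ℚ ℂ).injective] at hint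
  obtain ⟨n, hn⟩ := IsIntegrallyClosed.isIntegral_iff.mp hint
  have hn' : φ x * ψ x = (n : ℂ) := by rw [hmul, ← hn]; simp
  have hlt : ‖φ x * ψ x‖ < 1 := by
    rw [norm_mul]
    exact mul_lt_one_of_nonneg_of_lt_one_left (norm_nonneg _) hφ hψ.le
  rw [hn', Complex.norm_intCast] at hlt
  have hn0 : n = 0 := Int.abs_lt_one_iff.mp (by exact_mod_cast hlt)
  rw [hn0, Int.cast_zero, mul_eq_zero, map_eq_zero φ, map_eq_zero ψ, or_self] at hn'
  exact hx (RingOfIntegers.coe_eq_zero_iff.mp hn')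

open scoped Classical in
theorem exists_not_isRatLinear_norm_le [IsTotallyReal K] (hdeg : Module.finrank ℚ K = 4)
    (hD : Squarefree D) (hD1 : 1 < D) (hs : s ^ 2 = D) :
    ∃ x : 𝓞 K, ¬ IsRatLinear s (x : K) ∧ ∀ φ : K →+* ℂ, ‖φ x‖ ≤ 5 * √√|(discr K : ℝ)| := by
  obtain ⟨φ⟩ : Nonempty (K →+* ℂ) := inferInstance
  obtain ⟨ψ, hψ⟩ := exists_embedding_eq_neg hD hD1 hs φ
  have hs0 : φ s ≠ 0 := by
    rw [Ne, map_eq_zero]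
    rintro rfl
    have : D = 0 := by exact_mod_cast (by simpa using hs.symm : (D : K) = 0)
    omega
  have hne : InfinitePlace.mk φ ≠ InfinitePlace.mk ψ := by
    rw [Ne, mk_eq_iff, ComplexEmbedding.isReal_iff.mp (IsTotallyReal.complexEmbedding_isReal φ),
      or_self]
    rintro rfl
    exact hs0 (CharZero.eq_neg_self_iff.mp hψ)
  let M : NNReal := 5 * NNReal.sqrt (NNReal.sqrt ‖discr K‖₊)
  have hM : (M : ℝ) = 5 * √√|(discr K : ℝ)| := by
    simp only [M, NNReal.coe_mul, Real.coe_sqrt, coe_nnnorm, Int.norm_eq_abs]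
    rfl
  have hM1 : 1 ≤ (M : ℝ) := by
    have : (1 : ℝ) ≤ |(discr K : ℝ)| := by
      exact_mod_cast Int.one_le_abs (discr_ne_zero K)
    rw [hM]
    have := Real.one_le_sqrt.mpr (Real.one_le_sqrt.mpr this)
    linarith
  let f : InfinitePlace K → NNReal := fun w ↦
    if w ∈ ({InfinitePlace.mk φ, InfinitePlace.mk ψ} : Finset (InfinitePlace K)) then 1 else M
  have hcard : Fintype.card (InfinitePlace K) = 4 := by
    rw [card_eq_nrRealPlaces_add_nrComplexPlaces, IsTotallyReal.nrComplexPlaces_eq_zero, add_zero,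
      ← IsTotallyReal.finrank, hdeg]
  have hprod : ∏ w, f w ^ w.mult = M ^ 2 := by
    simp only [f, IsTotallyReal.mult_eq, pow_one]
    rw [Finset.prod_ite, Finset.prod_const_one, one_mul, Finset.prod_const, Finset.filter_not,
      Finset.filter_mem_eq_inter, Finset.univ_inter, ← Finset.compl_eq_univ_sdiff,
      Finset.card_compl, hcard, Finset.card_pair hne]
  have hvol : minkowskiBound K ↑1 < MeasureTheory.volume (convexBodyLT K f) := by
    rw [convexBodyLT_volume, minkowskiBound, volume_fundamentalDomain_fractionalIdealLatticeBasis,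
      volume_fundamentalDomain_latticeBasis, mixedEmbedding.finrank, hdeg,
      IsTotallyReal.nrComplexPlaces_eq_zero, pow_zero, one_mul, Units.val_one, map_one]
    have hpos : 0 < NNReal.sqrt ‖discr K‖₊ :=
      NNReal.sqrt_pos.mpr (nnnorm_pos.mpr (discr_ne_zero K))
    have hlt : NNReal.sqrt ‖discr K‖₊ * 2 ^ 4 < convexBodyLTFactor K * ∏ w, f w ^ w.mult := by
      rw [hprod, mul_pow, NNReal.sq_sqrt]
      calc _ = 16 * NNReal.sqrt ‖discr K‖₊ := by ring
        _ < 25 * NNReal.sqrt ‖discr K‖₊ := by gcongr; norm_num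
        _ ≤ 1 * (5 ^ 2 * NNReal.sqrt ‖discr K‖₊) := by norm_num
        _ ≤ _ := by gcongr; exact one_le_convexBodyLTFactor K
    simpa using ENNReal.coe_lt_coe.mpr hlt
  obtain ⟨x, hx0, hx⟩ := exists_ne_zero_mem_ringOfIntegers_lt K hvol
  refine ⟨x, not_isRatLinear_of_norm_lt_one hs hψ hx0 ?_ ?_, fun σ ↦ ?_⟩
  · simpa [f] using hx (InfinitePlace.mk φ)
  · simpa [f] using hx (InfinitePlace.mk ψ)
  · rw [← hM]
    refine (hx (InfinitePlace.mk σ)).le.trans ?_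
    simp only [f]
    split_ifs
    · exact hM1
    · rfl

end

section
variable {K : Type*} [Field K] [NumberField K] {D : ℤ} {s : K}

theorem sq_norm_le_norm_sum_sq {φ : K →+* ℂ} (hφ : ∀ x, (φ x).im = 0) {ι : Type*} [Fintype ι]
    (y : ι → K) (i : ι) : ‖φ (y i)‖ ^ 2 ≤ ‖φ (∑ j, y j ^ 2)‖ := by
  have hre (x : K) : φ x = ((φ x).re : ℂ) := Complex.ext rfl (by simp [hφ x])
  have hsum : φ (∑ j, y j ^ 2) = ((∑ j, (φ (y j)).re ^ 2 : ℝ) : ℂ) := by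
    push_cast
    simp only [← hre, map_sum, map_pow]
  rw [hsum, hre (y i), Complex.norm_real, Complex.norm_real, Real.norm_eq_abs, sq_abs]
  exact (Finset.single_le_sum (f := fun j ↦ (φ (y j)).re ^ 2) (fun _ _ ↦ sq_nonneg _)
    (Finset.mem_univ i)).trans (le_abs_self _)

theorem IsRatLinear.of_mul_add {x : K} {m : ℕ} (hm : 0 < m) (n : ℕ)
    (h : IsRatLinear s (m * (x + n))) : IsRatLinear s x := by
  obtain ⟨a, b, hab⟩ := h
  have hm' : (m : K) ≠ 0 := by exact_mod_cast hm.ne'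
  refine ⟨a / m - n, b / m, ?_⟩
  push_cast
  field_simp
  linear_combination hab

theorem sqrt_abs_discr_le_of_isSumOfSquares (htr : ∀ (σ : K →+* ℂ) (x : K), (σ x).im = 0)
    (hdeg : Module.finrank ℚ K = 4) (hD : Squarefree D) (hD1 : 1 < D) (hs : s ^ 2 = D)
    {β : 𝓞 K} (hβ : ¬ IsRatLinear s (β : K)) (hsum : IsSumOfSquares β) {c : ℝ}
    (hc : ∀ φ : K →+* ℂ, ‖φ β‖ ≤ c) : √|(discr K : ℝ)| ≤ 96 * D * c := by
  obtain ⟨k, y, hy⟩ := hsum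
  have hyK : (β : K) = ∑ i, (y i : K) ^ 2 := by rw [hy]; simp
  obtain ⟨i, hi⟩ : ∃ i, ¬ IsRatLinear s (y i : K) := by
    by_contra! h
    exact hβ (hyK ▸ .sum _ fun i _ ↦ (h i).sq hs)
  have hsint : IsIntegral ℤ s := .of_pow two_pos (by
    rw [hs]; exact isIntegral_algebraMap (R := ℤ) (A := K) (x := D))
  have hD0 : (0 : ℝ) < D := by exact_mod_cast (by omega : 0 < D)
  have hsn (φ : K →+* ℂ) : ‖φ s‖ ^ 2 = D := by
    rw [← norm_pow, ← map_pow, hs, map_intCast, Complex.norm_intCast, abs_of_pos hD0]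
  calc √|(discr K : ℝ)| ≤ 24 * D * ∑ φ : K →+* ℂ, ‖φ (y i)‖ ^ 2 :=
        sqrt_abs_discr_le_sum_norm_sq hdeg ⟨s, hsint⟩ (y i) hsn
          (linearIndependent_of_not_isRatLinear hD hD1 hs hi)
    _ ≤ 24 * D * ∑ φ : K →+* ℂ, c := by
        gcongr with φ
        refine (sq_norm_le_norm_sum_sq (htr φ) (fun j ↦ (y j : K)) i).trans ?_
        rw [← hyK]
        exact hc φ
    _ = 96 * D * c := by
        rw [Finset.sum_const, Finset.card_univ, NumberField.Embeddings.card, hdeg]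
        ring

end

/-- Fix a squarefree integer `D > 1` and `ε > 0`. There is `C > 0` (depending on `D` and `ε`)
such that for every totally real quartic field `K` containing `√D` with discriminant `Δ` and
every positive integer `m ≤ C Δ^(1/4 - ε)`, there is an element of `m 𝓞_K⁺` that is not a sum
of squares of elements of `𝓞_K`. -/
theorem stmt9 (D : ℤ) (hD : Squarefree D) (hD1 : 1 < D) (ε : ℝ) (hε : 0 < ε) :
    ∃ C : ℝ, 0 < C ∧
      ∀ (K : Type) [Field K] [NumberField K],
        (∀ (σ : K →+* ℂ) (x : K), (σ x).im = 0) →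
        Module.finrank ℚ K = 4 →
        (∃ s : K, s ^ 2 = (D : K)) →
        ∀ m : ℕ, 0 < m →
          (m : ℝ) ≤ C * (|NumberField.discr K| : ℝ) ^ ((1 : ℝ) / 4 - ε) →
          ∃ α : 𝓞 K, TotallyPositive K α ∧ ¬ IsSumOfSquares ((m : 𝓞 K) * α) := by
  have hD0 : (0 : ℝ) < D := by exact_mod_cast (by omega : 0 < D)
  refine ⟨1 / (1153 * D), by positivity, fun K _ _ htr hdeg ⟨s, hs⟩ m hm hmC ↦ ?_⟩
  have : IsTotallyReal K := ⟨fun v ↦ by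
    rw [← v.mk_embedding, InfinitePlace.isReal_mk_iff, ComplexEmbedding.isReal_iff]
    exact RingHom.ext fun x ↦ Complex.conj_eq_iff_im.mpr (htr _ x)⟩
  obtain ⟨x, hx, hxle⟩ := exists_not_isRatLinear_norm_le hdeg hD hD1 hs
  set q := √√|(discr K : ℝ)| with hq
  have hdisc : (1 : ℝ) ≤ |(discr K : ℝ)| := by exact_mod_cast Int.one_le_abs (discr_ne_zero K)
  have hq1 : 1 ≤ q := Real.one_le_sqrt.mpr (Real.one_le_sqrt.mpr hdisc)
  have hmq : (m : ℝ) ≤ 1 / (1153 * D) * q := by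
    refine hmC.trans ?_
    gcongr
    calc _ ≤ |(discr K : ℝ)| ^ ((1 : ℝ) / 4) := Real.rpow_le_rpow_of_exponent_le hdisc (by linarith)
      _ = q := by
        rw [hq, Real.sqrt_eq_rpow, Real.sqrt_eq_rpow, ← Real.rpow_mul (abs_nonneg _)]
        norm_num
  let n := ⌈5 * q⌉₊ + 1
  have hn : 5 * q < n := by
    simpa [n] using (Nat.le_ceil (5 * q)).trans_lt (lt_add_one _)
  have hn' : (n : ℝ) ≤ 7 * q := by
    have := Nat.ceil_lt_add_one (by positivity : 0 ≤ 5 * q)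
    push_cast [n]
    linarith
  refine ⟨x + n, fun σ ↦ ?_, fun hsum ↦ ?_⟩
  · have h := hxle (Complex.ofRealHom.comp σ)
    rw [RingHom.comp_apply, Complex.ofRealHom_eq_coe, Complex.norm_real] at h
    have := (abs_le.mp h).1
    simp only [map_add, map_natCast]
    linarith
  · have hβ : ¬ IsRatLinear s (((m : 𝓞 K) * (x + n) : 𝓞 K) : K) := fun h ↦
      hx (.of_mul_add hm n (by simpa using h))
    have hbound (φ : K →+* ℂ) : ‖φ ((m : 𝓞 K) * (x + n) : 𝓞 K)‖ ≤ m * (12 * q) := by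
      simp only [map_mul, map_add, map_natCast, norm_mul, Complex.norm_natCast]
      gcongr
      refine (norm_add_le _ _).trans ?_
      rw [Complex.norm_natCast]
      linarith [hxle φ]
    have h := sqrt_abs_discr_le_of_isSumOfSquares htr hdeg hD hD1 hs hβ hsum hbound
    rw [← Real.mul_self_sqrt (Real.sqrt_nonneg |(discr K : ℝ)|), ← hq] at h
    have h1 : q ≤ 1152 * D * m := le_of_mul_le_mul_right (by linarith) (by linarith : 0 < q)
    rw [one_div_mul_eq_div, le_div_iff₀ (by positivity)] at hmq
    linarith
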